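/- arXiv:1201.5173 — 3 statements merged into one kernel-verified Lean document; each statement's English description precedes it below -/
import Mathlib

section
/- Let τ ∈ ℕ and let G₁, G₂, …, G_q be independent geometric random variables with parameters p₁, p₂, …, p_q ∈ (0,1] satisfying p₁ ≥ p₂ ≥ … ≥ p_q. Then for every permutation π of {1, 2, …, q}, Σ_{i=1}^{q} Pr(G_{π(1)} + G_{π(2)} + ⋯ + G_{π(i)} ≤ τ) ≤ Σ_{i=1}^{q} Pr(G₁ + G₂ + ⋯ + G_i ≤ τ); that is, serving clients in decreasing order of their success probabilities maximizes the expected number of deliveries within τ time-slots over all serving orders. -/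
open Finset

/-- `probSumLe p n τ` is the probability that `G₁ + ⋯ + G_n ≤ τ`, where
`G₁, …, G_n` are independent geometric random variables taking values in
`{1, 2, 3, …}` with `Pr(G_i = k) = p (i-1) * (1 - p (i-1)) ^ (k - 1)`
(i.e. with parameters `p 0, …, p (n-1)`).  It is computed by summing the joint
probability mass over all tuples of values `(k 0, …, k (n-1))`, each in
`{1, …, τ}`, whose total is at most `τ`. -/
noncomputable def probSumLe (p : ℕ → ℝ) (n τ : ℕ) : ℝ :=
  ∑ k ∈ (Fintype.piFinset fun _ : Fin n => Finset.Icc 1 τ).filter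
      (fun k => ∑ j, k j ≤ τ),
    ∏ j : Fin n, p j * (1 - p j) ^ (k j - 1)
/-- The delay operator of a geometric variable `G` with parameter `p`: it sends `f` to
`t ↦ 𝔼[f (t - G); G ≤ t]`, computed by conditioning on the first trial. -/
def geomStep (p : ℝ) (f : ℕ → ℝ) : ℕ → ℝ
  | 0 => 0
  | t + 1 => p * f t + (1 - p) * geomStep p f t

theorem geomStep_eq_sum (p : ℝ) (f : ℕ → ℝ) (t : ℕ) :
    geomStep p f t = ∑ k ∈ Finset.Icc 1 t, p * (1 - p) ^ (k - 1) * f (t - k) := by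
  have h : ∀ t, geomStep p f t =
      ∑ k ∈ Finset.range t, p * (1 - p) ^ k * f (t - (k + 1)) := by
    intro t
    induction t with
    | zero => simp [geomStep]
    | succ t ih =>
      rw [geomStep, ih, Finset.sum_range_succ', Finset.mul_sum, add_comm]
      congr 1
      · refine Finset.sum_congr rfl fun k _ => ?_
        rw [Nat.add_sub_add_right]
        ring
      · simp
  rw [h]
  refine Finset.sum_nbij' (fun k => k + 1) (fun k => k - 1) ?_ ?_ ?_ ?_ ?_ <;>
    simp <;> intros <;> omega

theorem mul_geomStep_sub (p r : ℝ) (f : ℕ → ℝ) (t : ℕ) :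
    p * geomStep r f t - r * geomStep p f t = (p - r) * geomStep p (geomStep r f) t := by
  induction t with
  | zero => simp [geomStep]
  | succ t ih =>
    simp only [geomStep]
    linear_combination (1 - p) * ih

theorem geomStep_comm (p r : ℝ) (f : ℕ → ℝ) :
    geomStep p (geomStep r f) = geomStep r (geomStep p f) := by
  rcases eq_or_ne p r with rfl | hne
  · rfl
  · funext t
    apply mul_left_cancel₀ (sub_ne_zero.2 hne)
    linear_combination -mul_geomStep_sub p r f t - mul_geomStep_sub r p f t

instance : LeftCommutative geomStep := ⟨geomStep_comm⟩

theorem geomStep_nonneg {p : ℝ} (hp : 0 ≤ p) (hp' : p ≤ 1) {f : ℕ → ℝ} (hf : 0 ≤ f) :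
    0 ≤ geomStep p f := by
  intro t
  induction t with
  | zero => simp [geomStep]
  | succ t ih =>
    exact add_nonneg (mul_nonneg hp (hf t)) (mul_nonneg (sub_nonneg.2 hp') ih)

theorem geomStep_le_self {p : ℝ} (hp' : p ≤ 1) {f : ℕ → ℝ} (hf : 0 ≤ f)
    (hm : Monotone f) : geomStep p f ≤ f := by
  intro t
  induction t with
  | zero => exact hf 0
  | succ t ih =>
    have h := mul_le_mul_of_nonneg_left ih (sub_nonneg.2 hp')
    have := hm t.le_succ
    simp only [geomStep]
    linarith

theorem monotone_geomStep {p : ℝ} (hp : 0 ≤ p) (hp' : p ≤ 1) {f : ℕ → ℝ} (hf : 0 ≤ f)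
    (hm : Monotone f) : Monotone (geomStep p f) := by
  refine monotone_nat_of_le_succ fun t => ?_
  have h := mul_le_mul_of_nonneg_left (geomStep_le_self hp' hf hm t) hp
  simp only [geomStep]
  linarith

theorem geomStep_mono {p r : ℝ} (hp : 0 ≤ p) (hpr : p ≤ r) (hr : r ≤ 1) {f g : ℕ → ℝ}
    (hf : 0 ≤ f) (hm : Monotone f) (hfg : f ≤ g) : geomStep p f ≤ geomStep r g := by
  intro t
  induction t with
  | zero => simp [geomStep]
  | succ t ih =>
    have h₁ := mul_le_mul_of_nonneg_left ih (sub_nonneg.2 hr)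
    have h₂ := mul_le_mul_of_nonneg_left (hfg t) (hp.trans hpr)
    have h₃ := mul_le_mul_of_nonneg_left (geomStep_le_self (hpr.trans hr) hf hm t)
      (sub_nonneg.2 hpr)
    simp only [geomStep]
    linarith

/-- `geomSumLe s t` is the probability that independent geometric variables whose parameters
form the multiset `s` have total at most `t`. -/
def geomSumLe (s : Multiset ℝ) : ℕ → ℝ := s.foldr geomStep 1

theorem geomSumLe_cons (a : ℝ) (s : Multiset ℝ) :
    geomSumLe (a ::ₘ s) = geomStep a (geomSumLe s) :=
  Multiset.foldr_cons ..

theorem geomSumLe_nonneg_and_monotone (s : Multiset ℝ) (hs : ∀ a ∈ s, 0 ≤ a ∧ a ≤ 1) :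
    0 ≤ geomSumLe s ∧ Monotone (geomSumLe s) := by
  induction s using Multiset.induction with
  | empty => exact ⟨zero_le_one' (ℕ → ℝ), monotone_const⟩
  | cons a s ih =>
    obtain ⟨h0, hm⟩ := ih fun b hb => hs b (Multiset.mem_cons_of_mem hb)
    obtain ⟨ha, ha'⟩ := hs a (Multiset.mem_cons_self a s)
    rw [geomSumLe_cons]
    exact ⟨geomStep_nonneg ha ha' h0, monotone_geomStep ha ha' h0 hm⟩

theorem probSumLe_succ (p : ℕ → ℝ) (n τ : ℕ) :
    probSumLe p (n + 1) τ =
      ∑ k ∈ Finset.Icc 1 τ, p n * (1 - p n) ^ (k - 1) * probSumLe p n (τ - k) := by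
  simp only [probSumLe, Finset.mul_sum]
  rw [Finset.sum_sigma']
  refine Finset.sum_bij' (fun k _ => ⟨k (Fin.last n), Fin.init k⟩)
    (fun x _ => Fin.snoc x.2 x.1) ?_ ?_ ?_ ?_ ?_
  · intro k hk
    simp only [Finset.mem_filter, Fintype.mem_piFinset, Finset.mem_Icc, Finset.mem_sigma,
      Fin.sum_univ_castSucc] at hk ⊢
    obtain ⟨h, hs⟩ := hk
    have hsum : ∑ j, Fin.init k j ≤ τ - k (Fin.last n) := Nat.le_sub_of_add_le hs
    refine ⟨h _, fun j => ⟨(h j.castSucc).1, le_trans ?_ hsum⟩, hsum⟩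
    exact Finset.single_le_sum (f := Fin.init k) (fun _ _ => Nat.zero_le _) (Finset.mem_univ j)
  · rintro ⟨a, k⟩ hk
    simp only [Finset.mem_filter, Fintype.mem_piFinset, Finset.mem_Icc, Finset.mem_sigma,
      Fin.sum_univ_castSucc, Fin.snoc_castSucc, Fin.snoc_last] at hk ⊢
    obtain ⟨ha, h, hs⟩ := hk
    refine ⟨fun j => ?_, by omega⟩
    refine Fin.lastCases ?_ (fun j => ?_) j
    · simpa using ha
    · have := h j
      simp only [Fin.snoc_castSucc]
      omega
  · intro k _
    exact Fin.snoc_init_self k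
  · rintro ⟨a, k⟩ _
    simp
  · intro k _
    rw [Fin.prod_univ_castSucc, mul_comm]
    rfl

theorem probSumLe_eq_geomSumLe (p : ℕ → ℝ) (n : ℕ) :
    probSumLe p n = geomSumLe ((Multiset.range n).map p) := by
  induction n with
  | zero =>
    funext τ
    simp [probSumLe, geomSumLe]
  | succ n ih =>
    funext τ
    rw [probSumLe_succ, Multiset.range_succ, Multiset.map_cons, geomSumLe_cons, ← ih,
      geomStep_eq_sum]

theorem geomSumLe_map_le_range {q : ℕ} {p : ℕ → ℝ} (hp : ∀ i < q, 0 ≤ p i ∧ p i ≤ 1)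
    (hmono : ∀ i j, i ≤ j → j < q → p j ≤ p i) (n : ℕ) (s : Finset ℕ) (hcard : s.card = n)
    (hs : ∀ i ∈ s, i < q) :
    geomSumLe (s.val.map p) ≤ geomSumLe ((Multiset.range n).map p) := by
  induction n generalizing s with
  | zero => simp [Finset.card_eq_zero.1 hcard]
  | succ n ih =>
    have hne : s.Nonempty := Finset.card_pos.1 (by omega)
    set m := s.max' hne
    have hmem : m ∈ s := s.max'_mem hne
    have hnm : n ≤ m := by
      have hsub : s ⊆ Finset.range (m + 1) := fun i hi =>
        Finset.mem_range.2 (Nat.lt_succ_of_le (s.le_max' i hi))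
      have := Finset.card_le_card hsub
      rw [Finset.card_range] at this
      omega
    have hmq := hs m hmem
    have hs' : ∀ i ∈ s.erase m, i < q := fun i hi => hs i (Finset.mem_of_mem_erase hi)
    have hval : s.val = m ::ₘ (s.erase m).val := by
      rw [Finset.erase_val, Multiset.cons_erase hmem]
    obtain ⟨h0, hmon⟩ := geomSumLe_nonneg_and_monotone ((s.erase m).val.map p) (by
      intro a ha
      obtain ⟨i, hi, rfl⟩ := Multiset.mem_map.1 ha
      exact hp i (hs' i hi))
    rw [hval, Multiset.range_succ, Multiset.map_cons, Multiset.map_cons, geomSumLe_cons,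
      geomSumLe_cons]
    exact geomStep_mono (hp m hmq).1 (hmono n m hnm hmq) (hp n (hnm.trans_lt hmq)).2 h0 hmon
      (ih _ (by rw [Finset.card_erase_of_mem hmem, hcard, Nat.add_sub_cancel]) hs')

/-- if `p₁ ≥ p₂ ≥ ⋯ ≥ p_q` (all in `(0,1]`) then for every
permutation `π` of `{1, …, q}` (formalized as a permutation of `ℕ` mapping
`{0, …, q-1}` into itself), serving in the order `π` gives at most the expected
number of deliveries of the identity (decreasing-probability) order:
`Σ_{i=1}^{q} Pr(G_{π(1)} + ⋯ + G_{π(i)} ≤ τ) ≤ Σ_{i=1}^{q} Pr(G₁ + ⋯ + G_i ≤ τ)`. -/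
theorem stmt3 (τ q : ℕ) (p : ℕ → ℝ)
    (hp_pos : ∀ i < q, 0 < p i) (hp_le : ∀ i < q, p i ≤ 1)
    (hmono : ∀ i, i + 1 < q → p (i + 1) ≤ p i)
    (π : Equiv.Perm ℕ) (hπ : ∀ i < q, π i < q) :
    ∑ i ∈ Finset.range q, probSumLe (fun j => p (π j)) (i + 1) τ ≤
      ∑ i ∈ Finset.range q, probSumLe p (i + 1) τ := by
  have hanti : ∀ i j, i ≤ j → j < q → p j ≤ p i := by
    intro i j hij
    induction j, hij using Nat.le_induction with
    | base => exact fun _ => le_rfl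
    | succ j _ ih => exact fun hj => (hmono j hj).trans (ih (Nat.lt_of_succ_lt hj))
  refine Finset.sum_le_sum fun i hi => ?_
  rw [probSumLe_eq_geomSumLe, probSumLe_eq_geomSumLe]
  have h := geomSumLe_map_le_range (fun j hj => ⟨(hp_pos j hj).le, hp_le j hj⟩) hanti (i + 1)
    ((Finset.range (i + 1)).map π.toEmbedding) (by simp) (by
      intro j hj
      obtain ⟨k, hk, rfl⟩ := Finset.mem_map.1 hj
      rw [Finset.mem_range] at hi hk
      exact hπ k (by omega)) τ
  rwa [Finset.map_val, Multiset.map_map] at h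
end

section
/- Let l ∈ ℕ with l ≥ 1, let τ ∈ ℕ, and let G₁, …, G_l be independent geometric random variables with parameters p₁ ≥ p₂ ≥ … ≥ p_l > 0 satisfying Σ_{i=1}^{l} 1/p_i ≤ τ. Then l − Σ_{i=1}^{l} Pr(G₁ + ⋯ + G_i ≤ τ) ≤ 1 + Σ_{i=1}^{l−1} min(1, i/(l−i)²). -/
open Finset

theorem mem_filter_piFinset_Icc_one {n τ : ℕ} {k : Fin n → ℕ} :
    k ∈ (Fintype.piFinset fun _ : Fin n => Finset.Icc 1 τ).filter (fun k => ∑ j, k j ≤ τ) ↔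
      (∀ j, 1 ≤ k j) ∧ ∑ j, k j ≤ τ := by
  simp only [mem_filter, Fintype.mem_piFinset, mem_Icc]
  refine ⟨fun h => ⟨fun j => (h.1 j).1, h.2⟩, fun h => ⟨fun j => ⟨h.1 j, ?_⟩, h.2⟩⟩
  exact (Finset.single_le_sum (fun i _ => Nat.zero_le (k i)) (mem_univ j)).trans h.2

theorem probSumLe_zero_left (p : ℕ → ℝ) (τ : ℕ) : probSumLe p 0 τ = 1 := by
  simp [probSumLe]

theorem probSumLe_succ_zero (p : ℕ → ℝ) (n : ℕ) : probSumLe p (n + 1) 0 = 0 := by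
  simp [probSumLe]

theorem probSumLe_nonneg {p : ℕ → ℝ} {n : ℕ} (τ : ℕ) (hp_pos : ∀ i < n, 0 < p i)
    (hp_le : ∀ i < n, p i ≤ 1) : 0 ≤ probSumLe p n τ :=
  Finset.sum_nonneg fun _ _ => Finset.prod_nonneg fun j _ =>
    mul_nonneg (hp_pos j j.2).le (pow_nonneg (sub_nonneg.2 (hp_le j j.2)) _)

/-- Conditioning on whether the last summand equals `1`. -/
theorem probSumLe_succ_succ (p : ℕ → ℝ) (n τ : ℕ) :
    probSumLe p (n + 1) (τ + 1) =
      p n * probSumLe p n τ + (1 - p n) * probSumLe p (n + 1) τ := by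
  unfold probSumLe
  rw [← Finset.sum_filter_add_sum_filter_not _
    (fun k : Fin (n + 1) → ℕ => k (Fin.last n) = 1), Finset.mul_sum, Finset.mul_sum]
  congr 1
  · refine Finset.sum_nbij' (fun k => Fin.init k) (fun k => Fin.snoc k 1) ?_ ?_ ?_ ?_ ?_
    · intro k hk
      rw [mem_filter, mem_filter_piFinset_Icc_one, Fin.sum_univ_castSucc] at hk
      rw [mem_filter_piFinset_Icc_one]
      obtain ⟨⟨h1, h2⟩, h3⟩ := hk
      refine ⟨fun j => h1 _, ?_⟩
      simp only [Fin.init]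
      omega
    · intro k hk
      rw [mem_filter_piFinset_Icc_one] at hk
      rw [mem_filter, mem_filter_piFinset_Icc_one, Fin.sum_univ_castSucc, Fin.forall_fin_succ']
      simpa using hk
    · intro k hk
      have h := Fin.snoc_init_self k
      rwa [(mem_filter.1 hk).2] at h
    · intro k _
      exact Fin.init_snoc (α := fun _ => ℕ) 1 k
    · intro k hk
      rw [Fin.prod_univ_castSucc, (mem_filter.1 hk).2]
      simp [Fin.init, mul_comm]
  · refine Finset.sum_nbij' (fun k => Fin.snoc (Fin.init k) (k (Fin.last n) - 1))
      (fun k => Fin.snoc (Fin.init k) (k (Fin.last n) + 1)) ?_ ?_ ?_ ?_ ?_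
    · intro k hk
      rw [mem_filter, mem_filter_piFinset_Icc_one, Fin.sum_univ_castSucc,
        Fin.forall_fin_succ'] at hk
      rw [mem_filter_piFinset_Icc_one, Fin.sum_univ_castSucc, Fin.forall_fin_succ']
      obtain ⟨⟨⟨h1, h2⟩, h3⟩, h4⟩ := hk
      simp only [Fin.snoc_castSucc, Fin.snoc_last, Fin.init]
      exact ⟨⟨h1, by omega⟩, by omega⟩
    · intro k hk
      rw [mem_filter_piFinset_Icc_one, Fin.sum_univ_castSucc, Fin.forall_fin_succ'] at hk
      rw [mem_filter, mem_filter_piFinset_Icc_one, Fin.sum_univ_castSucc, Fin.forall_fin_succ']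
      obtain ⟨⟨h1, h2⟩, h3⟩ := hk
      simp only [Fin.snoc_castSucc, Fin.snoc_last, Fin.init]
      exact ⟨⟨⟨h1, by omega⟩, by omega⟩, by omega⟩
    · intro k hk
      have h1 := (mem_filter_piFinset_Icc_one.1 (mem_filter.1 hk).1).1 (Fin.last n)
      simp only [Fin.init_snoc, Fin.snoc_last, Nat.sub_add_cancel h1]
      exact Fin.snoc_init_self k
    · intro k _
      simp only [Fin.init_snoc, Fin.snoc_last, Nat.add_sub_cancel]
      exact Fin.snoc_init_self k
    · intro k hk
      have h1 := (mem_filter_piFinset_Icc_one.1 (mem_filter.1 hk).1).1 (Fin.last n)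
      have h2 := (mem_filter.1 hk).2
      obtain ⟨m, hm⟩ : ∃ m, k (Fin.last n) = m + 2 := ⟨k (Fin.last n) - 2, by omega⟩
      rw [Fin.prod_univ_castSucc, Fin.prod_univ_castSucc, hm]
      simp only [Fin.snoc_castSucc, Fin.snoc_last, Fin.init, Fin.val_castSucc, Fin.val_last,
        show m + 2 - 1 = m + 1 by omega, show m + 1 - 1 = m by omega]
      ring

/-- Chebyshev's inequality for a sum of independent geometric random variables, with the second
moment taken about the point `τ - c`. -/
theorem one_sub_probSumLe_mul_sq_le {p : ℕ → ℝ} {c : ℝ} (hc : 0 ≤ c) (n τ : ℕ)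
    (hp_pos : ∀ i < n, 0 < p i) (hp_le : ∀ i < n, p i ≤ 1) :
    (1 - probSumLe p n τ) * c ^ 2 ≤
      ∑ i ∈ range n, (1 - p i) / p i ^ 2 + (∑ i ∈ range n, 1 / p i - τ + c) ^ 2 := by
  induction n generalizing τ with
  | zero =>
    rw [probSumLe_zero_left]
    simp only [sub_self, zero_mul, range_zero, sum_empty, zero_add]
    positivity
  | succ n ihn =>
    have ihn' := fun τ => ihn τ (fun i hi => hp_pos i (by omega)) fun i hi => hp_le i (by omega)
    induction τ with
    | zero =>
      have hV : 0 ≤ ∑ i ∈ range (n + 1), (1 - p i) / p i ^ 2 := sum_nonneg fun i hi =>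
        div_nonneg (sub_nonneg.2 (hp_le i (mem_range.1 hi))) (sq_nonneg _)
      have hM : 0 ≤ ∑ i ∈ range (n + 1), 1 / p i := sum_nonneg fun i hi =>
        div_nonneg zero_le_one (hp_pos i (mem_range.1 hi)).le
      rw [probSumLe_succ_zero]
      push_cast
      nlinarith [mul_nonneg hM hc]
    | succ τ ihτ =>
      have hp := hp_pos n (by omega)
      have hq := sub_nonneg.2 (hp_le n (by omega))
      have h1 := mul_le_mul_of_nonneg_left (ihn' τ) hp.le
      have h2 := mul_le_mul_of_nonneg_left ihτ hq
      rw [probSumLe_succ_succ]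
      rw [sum_range_succ, sum_range_succ] at h2 ⊢
      push_cast
      generalize ∑ i ∈ range n, (1 - p i) / p i ^ 2 = V at *
      generalize ∑ i ∈ range n, 1 / p i = M at *
      calc _ = p n * ((1 - probSumLe p n τ) * c ^ 2) +
            (1 - p n) * ((1 - probSumLe p (n + 1) τ) * c ^ 2) := by ring
        _ ≤ _ := add_le_add h1 h2
        _ = _ := by
          field_simp
          ring

theorem one_sub_probSumLe_le {τ l n : ℕ} {p : ℕ → ℝ} (hn : 1 ≤ n) (hnl : n < l)
    (hp_pos : ∀ i < l, 0 < p i) (hp_le : ∀ i < l, p i ≤ 1)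
    (hmono : ∀ i, i + 1 < l → p (i + 1) ≤ p i)
    (hsum : ∑ i ∈ range l, 1 / p i ≤ (τ : ℝ)) :
    1 - probSumLe p n τ ≤ (n : ℝ) / ((l : ℝ) - n) ^ 2 := by
  have hanti : ∀ i j, i ≤ j → j < l → p j ≤ p i := by
    intro i j hij
    induction j, hij using Nat.le_induction with
    | base => exact fun _ => le_rfl
    | succ j _ ih => exact fun hj => (hmono j hj).trans (ih (by omega))
  have hr : 0 < p n := hp_pos n hnl
  have hd : 0 < (l : ℝ) - n := sub_pos.2 (by exact_mod_cast hnl)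
  have hgap : ((l : ℝ) - n) / p n ≤ τ - ∑ i ∈ range n, 1 / p i := by
    have h := Finset.card_nsmul_le_sum (Ico n l) (fun i => 1 / p i) (1 / p n) fun i hi =>
      one_div_le_one_div_of_le (hp_pos i (mem_Ico.1 hi).2)
        (hanti n i (mem_Ico.1 hi).1 (mem_Ico.1 hi).2)
    rw [Nat.card_Ico, nsmul_eq_mul, Nat.cast_sub hnl.le, mul_one_div] at h
    rw [← sum_range_add_sum_Ico _ hnl.le] at hsum
    linarith
  have hvar : ∑ i ∈ range n, (1 - p i) / p i ^ 2 ≤ n / p n ^ 2 := by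
    have h := Finset.sum_le_card_nsmul (range n) (fun i => (1 - p i) / p i ^ 2) (1 / p n ^ 2)
      fun i hi => by
        have hi := mem_range.1 hi
        have := hp_pos i (by omega)
        exact div_le_div₀ zero_le_one (by linarith) (by positivity)
          (pow_le_pow_left₀ hr.le (hanti i n hi.le hnl) 2)
    rwa [card_range, nsmul_eq_mul, mul_one_div] at h
  set c := (τ : ℝ) - ∑ i ∈ range n, 1 / p i with hc
  have hgap_pos : 0 < ((l : ℝ) - n) / p n := div_pos hd hr
  have hcpos : 0 < c := hgap_pos.trans_le hgap
  have hcheb := one_sub_probSumLe_mul_sq_le hcpos.le n τ (fun i hi => hp_pos i (by omega))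
    fun i hi => hp_le i (by omega)
  rw [show ∑ i ∈ range n, 1 / p i - τ + c = 0 by rw [hc]; ring] at hcheb
  calc 1 - probSumLe p n τ ≤ (n / p n ^ 2) / c ^ 2 := by
        rw [le_div_iff₀ (by positivity)]
        linarith
    _ ≤ (n / p n ^ 2) / (((l : ℝ) - n) / p n) ^ 2 := by gcongr
    _ = n / ((l : ℝ) - n) ^ 2 := by field_simp

/-- if `p₁ ≥ ⋯ ≥ p_l > 0` (all in `(0,1]`) and
`Σ_{i=1}^{l} 1/p_i ≤ τ`, then
`l − Σ_{i=1}^{l} Pr(G₁ + ⋯ + G_i ≤ τ) ≤ 1 + Σ_{i=1}^{l-1} min(1, i/(l-i)²)`. -/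
theorem stmt6 (τ l : ℕ) (hl : 1 ≤ l) (p : ℕ → ℝ)
    (hp_pos : ∀ i < l, 0 < p i) (hp_le : ∀ i < l, p i ≤ 1)
    (hmono : ∀ i, i + 1 < l → p (i + 1) ≤ p i)
    (hsum : ∑ i ∈ Finset.range l, 1 / p i ≤ (τ : ℝ)) :
    (l : ℝ) - ∑ i ∈ Finset.range l, probSumLe p (i + 1) τ ≤
      1 + ∑ i ∈ Finset.Icc 1 (l - 1), min 1 ((i : ℝ) / ((l : ℝ) - (i : ℝ)) ^ 2) := by
  have hnonneg : ∀ i < l, 0 ≤ probSumLe p (i + 1) τ := fun i hi =>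
    probSumLe_nonneg τ (fun j hj => hp_pos j (by omega)) fun j hj => hp_le j (by omega)
  obtain ⟨m, rfl⟩ : ∃ m, l = m + 1 := ⟨l - 1, by omega⟩
  rw [Nat.add_sub_cancel, ← Finset.Ico_add_one_right_eq_Icc, Finset.sum_Ico_eq_sum_range,
    Nat.add_sub_cancel, sum_range_succ]
  have hlast := hnonneg m (by omega)
  have h : ∑ i ∈ range m, (1 - probSumLe p (i + 1) τ) ≤ ∑ i ∈ range m,
      min 1 (((1 + i : ℕ) : ℝ) / (((m + 1 : ℕ) : ℝ) - ((1 + i : ℕ) : ℝ)) ^ 2) := by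
    refine sum_le_sum fun i hi => ?_
    have hi := mem_range.1 hi
    rw [add_comm 1 i]
    exact le_min (by linarith [hnonneg i (by omega)])
      (one_sub_probSumLe_le (by omega) (by omega) hp_pos hp_le hmono hsum)
  rw [sum_sub_distrib] at h
  simp only [sum_const, card_range, nsmul_eq_mul, mul_one] at h
  push_cast at h ⊢
  linarith
end

section
/- Let τ, l ∈ ℕ with 1 ≤ l < τ, set p = l/τ, and let B be a binomial random variable with τ trials and success probability p. Then l − E[min(B, l)] > e^{−1/6} · √((1−p)/(2π)) · √l. Consequently, the additive gap between the deterministic-relaxation value and the total timely throughput can be at least a constant multiple of √l in this symmetric configuration. -/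
open Finset

/-- Telescoping identity behind de Moivre's formula for the mean absolute deviation of the
binomial distribution. -/
theorem sum_range_mean_sub_mul_binomial (n k : ℕ) (hk : k ≤ n) (p : ℝ) :
    ∑ j ∈ range k, (n * p - j) * ((n.choose j : ℝ) * p ^ j * (1 - p) ^ (n - j)) =
      k * (1 - p) * ((n.choose k : ℝ) * p ^ k * (1 - p) ^ (n - k)) := by
  induction k with
  | zero => simp
  | succ k ih =>
    rw [sum_range_succ, ih (by omega)]
    have hchoose : (n.choose (k + 1) : ℝ) * (k + 1) = n.choose k * (n - k) := by
      rw [← Nat.cast_sub (by omega)]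
      exact_mod_cast Nat.choose_succ_right_eq n k
    obtain ⟨m, rfl⟩ : ∃ m, n = k + 1 + m := ⟨n - (k + 1), by omega⟩
    rw [show k + 1 + m - k = m + 1 by omega, show k + 1 + m - (k + 1) = m by omega]
    push_cast at hchoose ⊢
    linear_combination (-(p ^ (k + 1) * (1 - p) ^ (m + 1))) * hchoose

theorem sum_range_binomial_eq_one (n : ℕ) (p : ℝ) :
    ∑ j ∈ range (n + 1), (n.choose j : ℝ) * p ^ j * (1 - p) ^ (n - j) = 1 := by
  have h := add_pow p (1 - p) n
  rw [add_sub_cancel, one_pow] at h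
  refine (sum_congr rfl fun j _ => ?_).trans h.symm
  ring

/-- The expected shortfall of a binomial variable below its integer mean `l`. -/
theorem sub_sum_min_mul_binomial {n l : ℕ} (hl : l ≤ n) {p : ℝ} (hp : n * p = l) :
    (l : ℝ) - ∑ j ∈ range (n + 1),
        ((min j l : ℕ) : ℝ) * (n.choose j : ℝ) * p ^ j * (1 - p) ^ (n - j) =
      l * (1 - p) * ((n.choose l : ℝ) * p ^ l * (1 - p) ^ (n - l)) := by
  rw [← sum_range_mean_sub_mul_binomial n l hl p]
  have hone : (l : ℝ) =
      ∑ j ∈ range (n + 1), l * ((n.choose j : ℝ) * p ^ j * (1 - p) ^ (n - j)) := by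
    rw [← mul_sum, sum_range_binomial_eq_one, mul_one]
  conv_lhs => rw [hone]
  rw [← sum_sub_distrib]
  symm
  refine sum_subset_zero_on_sdiff (range_subset_range.2 (by omega)) ?_ ?_
  · intro j hj
    simp only [mem_sdiff, mem_range] at hj
    rw [min_eq_right (by omega)]
    ring
  · intro j hj
    rw [min_eq_left (mem_range.1 hj).le, hp]
    ring

theorem factorial_eq_stirlingSeq_mul {n : ℕ} (hn : n ≠ 0) :
    (n.factorial : ℝ) = Stirling.stirlingSeq n * (√(2 * n) * (n / Real.exp 1) ^ n) := by
  have : (0 : ℝ) < n := by positivity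
  rw [Stirling.stirlingSeq, div_mul_cancel₀]
  positivity

theorem stirlingSeq_pos {n : ℕ} (hn : n ≠ 0) : 0 < Stirling.stirlingSeq n :=
  (Real.sqrt_pos.2 Real.pi_pos).trans_le (Stirling.sqrt_pi_le_stirlingSeq hn)

theorem stirlingSeq_lt_exp_mul_sqrt_pi {n : ℕ} (hn : n ≠ 0) :
    Stirling.stirlingSeq n < Real.exp (1 / 12) * √Real.pi := by
  obtain ⟨m, rfl⟩ := Nat.exists_eq_succ_of_ne_zero hn
  have hle : Stirling.stirlingSeq (m + 1) ≤ Stirling.stirlingSeq 1 :=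
    Stirling.stirlingSeq'_antitone (Nat.zero_le m)
  refine hle.trans_lt ?_
  rw [Stirling.stirlingSeq_one]
  refine lt_of_pow_lt_pow_left₀ 12 (by positivity) ?_
  have hpi : √Real.pi ^ 12 = Real.pi ^ 6 := by
    rw [show 12 = 2 * 6 from rfl, pow_mul, Real.sq_sqrt Real.pi_pos.le]
  have htwo : √(2 : ℝ) ^ 12 = 64 := by
    rw [show 12 = 2 * 6 from rfl, pow_mul, Real.sq_sqrt (by norm_num)]
    norm_num
  have hexp : Real.exp (1 / 12) ^ 12 = Real.exp 1 := by
    rw [← Real.exp_nat_mul]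
    norm_num
  rw [div_pow, mul_pow, htwo, hpi, hexp, div_lt_iff₀ (by norm_num)]
  have hpow : Real.exp 1 ^ 11 < 64 * Real.pi ^ 6 :=
    calc Real.exp 1 ^ 11 < 2.7182818286 ^ 11 :=
          pow_lt_pow_left₀ Real.exp_one_lt_d9 (Real.exp_pos 1).le (by norm_num)
      _ < 64 * 3.14 ^ 6 := by norm_num
      _ < 64 * Real.pi ^ 6 := by
          gcongr
          exact Real.pi_gt_d2
  calc Real.exp 1 ^ 12 = Real.exp 1 * Real.exp 1 ^ 11 := by ring
    _ < Real.exp 1 * (64 * Real.pi ^ 6) := by gcongr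
    _ = Real.exp 1 * Real.pi ^ 6 * 64 := by ring

/-- The binomial probability at an integer mean, in terms of the Stirling sequence. -/
theorem choose_mul_pow_eq_stirlingSeq {l m : ℕ} (hl : l ≠ 0) (hm : m ≠ 0) :
    ((l + m).choose l : ℝ) * ((l : ℝ) / (l + m)) ^ l * ((m : ℝ) / (l + m)) ^ m =
      Stirling.stirlingSeq (l + m) / (Stirling.stirlingSeq l * Stirling.stirlingSeq m) *
        (√(2 * (l + m)) / (√(2 * l) * √(2 * m))) := by
  have hl' : (0 : ℝ) < l := by positivity
  have hm' : (0 : ℝ) < m := by positivity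
  have hsl := (stirlingSeq_pos hl).ne'
  have hsm := (stirlingSeq_pos hm).ne'
  rw [Nat.cast_add_choose, factorial_eq_stirlingSeq_mul (n := l + m) (by omega),
    factorial_eq_stirlingSeq_mul hl, factorial_eq_stirlingSeq_mul hm]
  push_cast
  have h1 : √(2 * (l : ℝ)) ≠ 0 := by positivity
  have h2 : √(2 * (m : ℝ)) ≠ 0 := by positivity
  simp only [div_pow, pow_add]
  field_simp

/-- for `1 ≤ l < τ` and `p = l/τ`, with `B` binomial with `τ`
trials and success probability `p`,
`l − E[min(B,l)] > e^{−1/6}·√((1−p)/(2π))·√l`. -/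
theorem stmt9 (τ l : ℕ) (hl : 1 ≤ l) (hlτ : l < τ) :
    Real.exp (-(1 / 6)) * Real.sqrt ((1 - (l : ℝ) / τ) / (2 * Real.pi)) *
        Real.sqrt l <
      (l : ℝ) - ∑ j ∈ Finset.range (τ + 1),
        ((min j l : ℕ) : ℝ) * (τ.choose j : ℝ) * ((l : ℝ) / τ) ^ j *
          (1 - (l : ℝ) / τ) ^ (τ - j) := by
  obtain ⟨m, rfl⟩ : ∃ m, τ = l + m := ⟨τ - l, by omega⟩
  have hl0 : l ≠ 0 := by omega
  have hm0 : m ≠ 0 := by omega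
  have hl' : (0 : ℝ) < l := by positivity
  have hm' : (0 : ℝ) < m := by positivity
  rw [sub_sum_min_mul_binomial hlτ.le (by push_cast; field_simp), Nat.add_sub_cancel_left]
  push_cast
  rw [show 1 - (l : ℝ) / (l + m) = m / (l + m) by field_simp; ring,
    choose_mul_pow_eq_stirlingSeq hl0 hm0]
  set q : ℝ := m / (l + m) with hq
  have hq0 : 0 < q := by positivity
  have hsl := stirlingSeq_pos hl0
  have hsm := stirlingSeq_pos hm0
  have hpi := Real.sqrt_pos.2 Real.pi_pos
  have hsqrt : l * q * (√(2 * ((l : ℝ) + m)) / (√(2 * l) * √(2 * m))) = √(l * q / 2) := by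
    rw [← Real.sqrt_mul (by positivity), ← Real.sqrt_div (by positivity)]
    nth_rewrite 1 [← Real.sqrt_sq (show (0 : ℝ) ≤ l * q by positivity)]
    rw [← Real.sqrt_mul (by positivity)]
    congr 1
    rw [hq]
    field_simp
  have hlhs : Real.exp (-(1 / 6)) * √(q / (2 * Real.pi)) * √l =
      Real.exp (-(1 / 6)) / √Real.pi * √(l * q / 2) := by
    rw [mul_assoc, ← Real.sqrt_mul (by positivity), div_mul_eq_mul_div _ (√Real.pi),
      mul_div_assoc, ← Real.sqrt_div (by positivity)]
    congr 2
    field_simp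
  have hratio : Real.exp (-(1 / 6)) / √Real.pi < Stirling.stirlingSeq (l + m) /
      (Stirling.stirlingSeq l * Stirling.stirlingSeq m) := by
    rw [div_lt_div_iff₀ hpi (by positivity)]
    have hexp : Real.exp (-(1 / 6)) * (Real.exp (1 / 12) * Real.exp (1 / 12)) = 1 := by
      rw [← Real.exp_add, ← Real.exp_add]
      norm_num
    calc Real.exp (-(1 / 6)) * (Stirling.stirlingSeq l * Stirling.stirlingSeq m)
        < Real.exp (-(1 / 6)) *
            ((Real.exp (1 / 12) * √Real.pi) * (Real.exp (1 / 12) * √Real.pi)) := by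
          gcongr <;> exact stirlingSeq_lt_exp_mul_sqrt_pi ‹_›
      _ = √Real.pi * √Real.pi := by linear_combination (√Real.pi * √Real.pi) * hexp
      _ ≤ Stirling.stirlingSeq (l + m) * √Real.pi := by
          gcongr
          exact Stirling.sqrt_pi_le_stirlingSeq (by omega)
  rw [hlhs, mul_left_comm, hsqrt]
  gcongr
end
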